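/- The modified Berne interaction potential U is uniformly bounded: 0 ≤ U(r, r̄, θ, θ̄) ≤ ε₀(l²+d²)/(2ld) for all r, r̄ ∈ ℝ² and θ, θ̄ ∈ ℝ. -/

import Mathlib

open Real Matrix

noncomputable section

/-- The anisotropy parameter λ = (l²−d²)/(l²+d²). -/
def lam (l d : ℝ) : ℝ := (l ^ 2 - d ^ 2) / (l ^ 2 + d ^ 2)

/-- The orientation vector η(θ) = (cos θ, sin θ). -/
def eta (θ : ℝ) : Fin 2 → ℝ := ![Real.cos θ, Real.sin θ]

/-- The amplitude a(θ,θ̄) = ε₀ (1 − λ² (η(θ)·η(θ̄))²)^{-1/2}. -/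
def aAmp (l d ε₀ θ θ' : ℝ) : ℝ :=
  ε₀ / Real.sqrt (1 - (lam l d) ^ 2 * (eta θ ⬝ᵥ eta θ') ^ 2)

/-- The shape matrix γ(θ) = (l²−d²) η(θ)η(θ)ᵀ + d² I. -/
def gam (l d θ : ℝ) : Matrix (Fin 2) (Fin 2) ℝ :=
  (l ^ 2 - d ^ 2) • Matrix.vecMulVec (eta θ) (eta θ) + d ^ 2 • (1 : Matrix (Fin 2) (Fin 2) ℝ)

/-- The quadratic form Q_{θ,θ̄}(x) = xᵀ (γ(θ)+γ(θ̄))⁻¹ x. -/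
def Qform (l d θ θ' : ℝ) (x : Fin 2 → ℝ) : ℝ :=
  x ⬝ᵥ (gam l d θ + gam l d θ')⁻¹ *ᵥ x

/-- The cutoff profile φ(t) = exp(−t/(1−t)) for t < 1, φ(t) = 0 for t ≥ 1. -/
def cutoff (t : ℝ) : ℝ := if t < 1 then Real.exp (-t / (1 - t)) else 0

/-- The modified Berne interaction potential U(r,r̄,θ,θ̄) = a(θ,θ̄) φ(Q_{θ,θ̄}(r̄−r)). -/
def Upot (l d ε₀ : ℝ) (r r' : Fin 2 → ℝ) (θ θ' : ℝ) : ℝ :=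
  aAmp l d ε₀ θ θ' * cutoff (Qform l d θ θ' (r' - r))

lemma posSemidef_gam {l d : ℝ} (h : d ^ 2 ≤ l ^ 2) (θ : ℝ) : (gam l d θ).PosSemidef := by
  have hv : (Matrix.vecMulVec (eta θ) (eta θ)).PosSemidef := by
    simpa using Matrix.posSemidef_vecMulVec_self_star (eta θ)
  exact (hv.smul (sub_nonneg.2 h)).add (Matrix.PosSemidef.one.smul (sq_nonneg d))

lemma Qform_nonneg {l d : ℝ} (h : d ^ 2 ≤ l ^ 2) (θ θ' : ℝ) (x : Fin 2 → ℝ) :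
    0 ≤ Qform l d θ θ' x := by
  simpa [Qform] using
    ((posSemidef_gam h θ).add (posSemidef_gam h θ')).inv.dotProduct_mulVec_nonneg x

lemma cutoff_nonneg (t : ℝ) : 0 ≤ cutoff t := by
  unfold cutoff
  split_ifs <;> positivity

lemma cutoff_le_one {t : ℝ} (ht : 0 ≤ t) : cutoff t ≤ 1 := by
  unfold cutoff
  split_ifs with h
  · exact Real.exp_le_one_iff.2
      (div_nonpos_of_nonpos_of_nonneg (neg_nonpos.2 ht) (sub_nonneg.2 h.le))
  · exact zero_le_one

lemma eta_dotProduct_eta (θ θ' : ℝ) : eta θ ⬝ᵥ eta θ' = Real.cos (θ - θ') := by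
  simp [eta, Real.cos_sub]

lemma one_sub_lam_sq {l d : ℝ} (h : l ^ 2 + d ^ 2 ≠ 0) :
    1 - lam l d ^ 2 = (2 * l * d / (l ^ 2 + d ^ 2)) ^ 2 := by
  unfold lam
  field_simp
  ring

lemma aAmp_nonneg {ε₀ : ℝ} (hε : 0 ≤ ε₀) (l d θ θ' : ℝ) : 0 ≤ aAmp l d ε₀ θ θ' :=
  div_nonneg hε (Real.sqrt_nonneg _)

lemma aAmp_le {l d ε₀ : ℝ} (hl : 0 < l) (hd : 0 < d) (hε : 0 ≤ ε₀) (θ θ' : ℝ) :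
    aAmp l d ε₀ θ θ' ≤ ε₀ * (l ^ 2 + d ^ 2) / (2 * l * d) := by
  have hpos : 0 < 2 * l * d / (l ^ 2 + d ^ 2) := by positivity
  have hsqrt : 2 * l * d / (l ^ 2 + d ^ 2) ≤
      Real.sqrt (1 - lam l d ^ 2 * (eta θ ⬝ᵥ eta θ') ^ 2) := by
    refine Real.le_sqrt_of_sq_le ?_
    rw [← one_sub_lam_sq (by positivity), eta_dotProduct_eta]
    exact sub_le_sub_left
      (mul_le_of_le_one_right (sq_nonneg _) (Real.cos_sq_le_one _)) 1
  calc aAmp l d ε₀ θ θ' ≤ ε₀ / (2 * l * d / (l ^ 2 + d ^ 2)) :=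
        div_le_div_of_nonneg_left hε hpos hsqrt
    _ = ε₀ * (l ^ 2 + d ^ 2) / (2 * l * d) := div_div_eq_mul_div _ _ _

theorem Upot_uniformly_bounded
    (l d ε₀ : ℝ) (hd : 0 < d) (hdl : d < l) (hε : 0 < ε₀) :
    ∀ (r r' : Fin 2 → ℝ) (θ θ' : ℝ),
      0 ≤ Upot l d ε₀ r r' θ θ' ∧
      Upot l d ε₀ r r' θ θ' ≤ ε₀ * (l ^ 2 + d ^ 2) / (2 * l * d) := by
  intro r r' θ θ'
  have ha := aAmp_nonneg hε.le l d θ θ'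
  have hQ := Qform_nonneg (pow_le_pow_left₀ hd.le hdl.le 2) θ θ' (r' - r)
  exact ⟨mul_nonneg ha (cutoff_nonneg _),
    (mul_le_of_le_one_right ha (cutoff_le_one hQ)).trans
      (aAmp_le (hd.trans hdl) hd hε.le θ θ')⟩
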